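/- Let γ > 1/2 and suppose A¹, A² ∈ C^γ([0,T]; C²(ℝ^d;ℝ^d)) with ‖A^i‖_{C^γ C²} ≤ R, and let θ^i ∈ C^γ solve θ^i_t = θ^i_0 + ∫₀^t A^i(ds, θ^i_s). Then there exists C = C(γ, T, R) such that ‖θ¹ − θ²‖_{C^γ} ≤ C(|θ¹_0 − θ²_0| + ‖A¹ − A²‖_{C^γ Lip}). -/

import Mathlib

def IsPartition {n : ℕ} (s t : ℝ) (τ : Fin (n + 1) → ℝ) : Prop :=
  Monotone τ ∧ τ 0 = s ∧ τ (Fin.last n) = t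

def MeshLE {n : ℕ} (τ : Fin (n + 1) → ℝ) (δ : ℝ) : Prop :=
  ∀ i : Fin n, τ i.succ - τ i.castSucc ≤ δ

/-- Nonlinear Young integral `∫_s^t A(du, θ_u)` as limit of Riemann–Stieltjes sums. -/
def IsNYIntegral {d : ℕ} (A : ℝ → (Fin d → ℝ) → Fin d → ℝ) (θ : ℝ → Fin d → ℝ)
    (s t : ℝ) (I : Fin d → ℝ) : Prop :=
  ∀ ε > (0:ℝ), ∃ δ > (0:ℝ), ∀ (n : ℕ) (τ : Fin (n + 1) → ℝ),
    IsPartition s t τ → MeshLE τ δ →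
      ‖(∑ i : Fin n,
          (A (τ i.succ) (θ (τ i.castSucc)) - A (τ i.castSucc) (θ (τ i.castSucc)))) - I‖ ≤ ε

open Filter Topology Finset in
theorem ny_tendsto {d : ℕ} {A : ℝ → (Fin d → ℝ) → Fin d → ℝ} {θ : ℝ → Fin d → ℝ}
    {s t : ℝ} {I : Fin d → ℝ} (hI : IsNYIntegral A θ s t I) (hst : s ≤ t) :
    Tendsto (fun n : ℕ => ∑ i ∈ range (2 ^ n),
      (A (s + ((i : ℝ) + 1) * ((t - s) / 2 ^ n)) (θ (s + (i : ℝ) * ((t - s) / 2 ^ n)))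
        - A (s + (i : ℝ) * ((t - s) / 2 ^ n)) (θ (s + (i : ℝ) * ((t - s) / 2 ^ n)))))
      atTop (𝓝 I) := by
  rw [Metric.tendsto_atTop]
  intro ε hε
  obtain ⟨δ, hδ, h⟩ := hI (ε / 2) (by linarith)
  have hlim : Tendsto (fun n : ℕ => (t - s) * ((1 / 2 : ℝ)) ^ n) atTop (𝓝 ((t - s) * 0)) :=
    (tendsto_pow_atTop_nhds_zero_of_lt_one (by norm_num) (by norm_num)).const_mul _
  rw [mul_zero] at hlim
  obtain ⟨N, hN⟩ := eventually_atTop.1 (hlim.eventually (gt_mem_nhds hδ))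
  refine ⟨N, fun n hn => ?_⟩
  have hm : (t - s) / 2 ^ n < δ := by
    have := hN n hn
    rwa [one_div, inv_pow, ← div_eq_mul_inv] at this
  have h0 : 0 ≤ (t - s) / 2 ^ n := div_nonneg (by linarith) (by positivity)
  have key := h (2 ^ n) (fun i => s + (i : ℕ) * ((t - s) / 2 ^ n)) ?_ ?_
  · rw [dist_eq_norm]
    refine lt_of_le_of_lt ?_ (half_lt_self hε)
    refine (le_of_eq ?_).trans key
    congr 2
    rw [← Fin.sum_univ_eq_sum_range (fun i : ℕ =>
      (A (s + ((i : ℝ) + 1) * ((t - s) / 2 ^ n)) (θ (s + (i : ℝ) * ((t - s) / 2 ^ n)))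
        - A (s + (i : ℝ) * ((t - s) / 2 ^ n)) (θ (s + (i : ℝ) * ((t - s) / 2 ^ n)))))]
    simp
  · refine ⟨?_, ?_, ?_⟩
    · intro i j hij
      have : ((i : ℕ) : ℝ) ≤ ((j : ℕ) : ℝ) := by exact_mod_cast hij
      have := mul_le_mul_of_nonneg_right this h0
      simpa using this
    · simp
    · simp only [Fin.val_last]
      push_cast
      field_simp
      ring
  · intro i
    simp only [Fin.val_succ, Fin.val_castSucc]
    push_cast
    nlinarith

open Filter Topology Finset in
theorem sewing {E : Type*} [NormedAddCommGroup E] (Ξ : ℝ → ℝ → E) (γ ρ c M a b : ℝ)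
    (hρ : ρ = 2 * ((1 / 2 : ℝ) ^ γ) ^ 2) (hc : c * ρ + 1 = c) (hc0 : 0 ≤ c)
    (hM : 0 ≤ M)
    (hδ : ∀ s u t, a ≤ s → s ≤ u → u ≤ t → t ≤ b →
      ‖Ξ s t - Ξ s u - Ξ u t‖ ≤ M * ((t - s) ^ γ) ^ 2)
    (s t : ℝ) (has : a ≤ s) (hst : s ≤ t) (htb : t ≤ b) (I : E)
    (hI : Tendsto (fun n : ℕ => ∑ i ∈ range (2 ^ n),
      Ξ (s + (i : ℝ) * ((t - s) / 2 ^ n)) (s + ((i : ℝ) + 1) * ((t - s) / 2 ^ n)))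
      atTop (𝓝 I)) :
    ‖I - Ξ s t‖ ≤ c * M * ((t - s) ^ γ) ^ 2 := by
  have main : ∀ n : ℕ, ∀ s h : ℝ, a ≤ s → 0 ≤ h → s + 2 ^ n * h ≤ b →
      ‖(∑ i ∈ range (2 ^ n), Ξ (s + (i : ℝ) * h) (s + ((i : ℝ) + 1) * h))
        - Ξ s (s + 2 ^ n * h)‖ ≤ c * M * ((2 ^ n * h) ^ γ) ^ 2 := by
    intro n
    induction n with
    | zero =>
      intro s h _ _ _
      simp
      positivity
    | succ n ih =>
      intro s h hs hh hb
      have hp : (0 : ℝ) ≤ 2 ^ n * h := by positivity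
      have e2 : (2 : ℝ) ^ (n + 1) * h = 2 ^ n * h + 2 ^ n * h := by ring
      have h1 := ih s h hs hh (by rw [e2] at hb; linarith)
      have h2 := ih (s + 2 ^ n * h) h (by linarith) hh (by rw [e2] at hb; linarith)
      have h3 := hδ s (s + 2 ^ n * h) (s + 2 ^ (n + 1) * h) hs (by linarith)
        (by rw [e2]; linarith) hb
      have hsum : (∑ i ∈ range (2 ^ (n + 1)), Ξ (s + (i : ℝ) * h) (s + ((i : ℝ) + 1) * h))
          = (∑ i ∈ range (2 ^ n), Ξ (s + (i : ℝ) * h) (s + ((i : ℝ) + 1) * h))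
          + ∑ i ∈ range (2 ^ n), Ξ (s + 2 ^ n * h + (i : ℝ) * h)
              (s + 2 ^ n * h + ((i : ℝ) + 1) * h) := by
        rw [pow_succ, mul_two, sum_range_add]
        congr 1
        refine sum_congr rfl fun i _ => ?_
        push_cast
        congr 1 <;> ring
      have e3 : s + 2 ^ n * h + 2 ^ n * h = s + 2 ^ (n + 1) * h := by ring
      rw [e3] at h2
      have e4 : (2 : ℝ) ^ n * h = (1 / 2) * (2 ^ (n + 1) * h) := by ring
      have e5 : ((2 : ℝ) ^ n * h) ^ γ = (1 / 2 : ℝ) ^ γ * (2 ^ (n + 1) * h) ^ γ := by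
        rw [e4, Real.mul_rpow (by norm_num) (by positivity)]
      rw [e5] at h1 h2
      rw [hsum]
      have e6 : s + 2 ^ (n + 1) * h - s = 2 ^ (n + 1) * h := by ring
      rw [e6] at h3
      set S1 := ∑ i ∈ range (2 ^ n), Ξ (s + (i : ℝ) * h) (s + ((i : ℝ) + 1) * h)
      set S2 := ∑ i ∈ range (2 ^ n), Ξ (s + 2 ^ n * h + (i : ℝ) * h)
              (s + 2 ^ n * h + ((i : ℝ) + 1) * h)
      set X := Ξ s (s + 2 ^ n * h)
      set Y := Ξ (s + 2 ^ n * h) (s + 2 ^ (n + 1) * h)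
      set Z := Ξ s (s + 2 ^ (n + 1) * h)
      set w := ((2 : ℝ) ^ (n + 1) * h) ^ γ
      set q := (1 / 2 : ℝ) ^ γ
      calc ‖S1 + S2 - Z‖ = ‖(S1 - X) + (S2 - Y) - (Z - X - Y)‖ := by congr 1; abel
        _ ≤ ‖S1 - X‖ + ‖S2 - Y‖ + ‖Z - X - Y‖ :=
          (norm_sub_le _ _).trans (add_le_add_left (norm_add_le _ _) _)
        _ ≤ c * M * (q * w) ^ 2 + c * M * (q * w) ^ 2 + M * w ^ 2 := by linarith
        _ = (c * ρ + 1) * M * w ^ 2 := by rw [hρ]; ring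
        _ = c * M * w ^ 2 := by rw [hc]
  refine le_of_tendsto ((hI.sub_const (Ξ s t)).norm) (Eventually.of_forall fun n => ?_)
  have e : (2 : ℝ) ^ n * ((t - s) / 2 ^ n) = t - s := by field_simp
  have := main n s ((t - s) / 2 ^ n) has (div_nonneg (by linarith) (by positivity))
    (by rw [e]; linarith)
  rw [e] at this
  simpa using this

open Filter Topology in
theorem boot {E : Type*} [NormedAddCommGroup E] (f : ℝ → E) (γ a b α K0 : ℝ) (hα : 0 ≤ α)
    (h0 : ∀ s t, a ≤ s → s ≤ t → t ≤ b → ‖f t - f s‖ ≤ K0 * (t - s) ^ γ)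
    (himp : ∀ K, 0 ≤ K → (∀ s t, a ≤ s → s ≤ t → t ≤ b → ‖f t - f s‖ ≤ K * (t - s) ^ γ) →
      ∀ s t, a ≤ s → s ≤ t → t ≤ b → ‖f t - f s‖ ≤ (α + K / 2) * (t - s) ^ γ) :
    ∀ s t, a ≤ s → s ≤ t → t ≤ b → ‖f t - f s‖ ≤ 2 * α * (t - s) ^ γ := by
  have main : ∀ n : ℕ, ∀ s t, a ≤ s → s ≤ t → t ≤ b →
      ‖f t - f s‖ ≤ (2 * α + |K0| * (1 / 2) ^ n) * (t - s) ^ γ := by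
    intro n
    induction n with
    | zero =>
      intro s t hs hst ht
      refine (h0 s t hs hst ht).trans ?_
      have : 0 ≤ (t - s) ^ γ := Real.rpow_nonneg (by linarith) _
      gcongr
      have := le_abs_self K0
      simp; linarith
    | succ n ih =>
      intro s t hs hst ht
      have := himp _ (by positivity) ih s t hs hst ht
      refine this.trans (le_of_eq ?_)
      ring
  intro s t hs hst ht
  have hl : Tendsto (fun n : ℕ => (2 * α + |K0| * (1 / 2 : ℝ) ^ n) * (t - s) ^ γ) atTop
      (𝓝 ((2 * α + |K0| * 0) * (t - s) ^ γ)) :=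
    (((tendsto_pow_atTop_nhds_zero_of_lt_one (by norm_num) (by norm_num)).const_mul _).const_add
      _).mul_const _
  rw [mul_zero, add_zero] at hl
  exact ge_of_tendsto hl (Eventually.of_forall fun n => main n s t hs hst ht)

theorem lip_of_deriv {E F : Type*} [NormedAddCommGroup E] [NormedSpace ℝ E]
    [NormedAddCommGroup F] [NormedSpace ℝ F]
    (f : E → F) (f' : E → E →L[ℝ] F) (L : ℝ) (hf : ∀ x, HasFDerivAt f (f' x) x)
    (hb : ∀ x, ‖f' x‖ ≤ L) (x y : E) : ‖f x - f y‖ ≤ L * ‖x - y‖ :=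
  convex_univ.norm_image_sub_le_of_norm_hasFDerivWithin_le
    (fun x _ => (hf x).hasFDerivWithinAt) (fun x _ => hb x) (Set.mem_univ y) (Set.mem_univ x)

theorem four_point {E : Type*} [NormedAddCommGroup E] [NormedSpace ℝ E]
    (f : E → E) (f' : E → E →L[ℝ] E) (L : ℝ) (hf : ∀ x, HasFDerivAt f (f' x) x)
    (hb : ∀ x, ‖f' x‖ ≤ L) (hl : ∀ x y, ‖f' x - f' y‖ ≤ L * ‖x - y‖) (x1 x2 y1 y2 : E) :
    ‖f x1 - f x2 - (f y1 - f y2)‖ ≤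
      L * ‖(x1 - y1) - (x2 - y2)‖ + L * ‖x2 - y2‖ * ‖y1 - y2‖ := by
  have h1 := lip_of_deriv f f' L hf hb x1 (y1 + (x2 - y2))
  have h2 := lip_of_deriv (fun z => f (z + (x2 - y2)) - f z)
    (fun z => f' (z + (x2 - y2)) - f' z) (L * ‖x2 - y2‖)
    (fun x => ((hasFDerivAt_comp_add_right (x2 - y2)).2 (hf _)).sub (hf x))
    (fun x => by simpa using hl (x + (x2 - y2)) x) y1 y2
  have e : f x1 - f x2 - (f y1 - f y2) = (f x1 - f (y1 + (x2 - y2))) +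
      ((f (y1 + (x2 - y2)) - f y1) - (f (y2 + (x2 - y2)) - f y2)) := by
    rw [show y2 + (x2 - y2) = x2 by abel]; abel
  rw [e]
  refine (norm_add_le _ _).trans (add_le_add ?_ h2)
  rwa [show x1 - y1 - (x2 - y2) = x1 - (y1 + (x2 - y2)) by abel]

theorem apriori {d : ℕ} (A : ℝ → (Fin d → ℝ) → Fin d → ℝ)
    (DA : ℝ → (Fin d → ℝ) → (Fin d → ℝ) →L[ℝ] (Fin d → ℝ)) (θ : ℝ → Fin d → ℝ)
    (γ ρ c T R K0 H a b : ℝ) (hγ : 0 < γ)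
    (hρ : ρ = 2 * ((1 / 2 : ℝ) ^ γ) ^ 2) (hc : c * ρ + 1 = c) (hc0 : 0 ≤ c) (hR : 0 ≤ R)
    (ha : 0 ≤ a) (hb : b ≤ T) (hH : c * R * H ≤ 1 / 8) (hbH : (b - a) ^ γ ≤ H)
    (hA : ∀ t x, HasFDerivAt (A t) (DA t x) x)
    (h1 : ∀ s ∈ Set.Icc 0 T, ∀ t ∈ Set.Icc 0 T, ∀ x : Fin d → ℝ,
        ‖A t x - A s x‖ ≤ R * |t - s| ^ γ)
    (h2 : ∀ s ∈ Set.Icc 0 T, ∀ t ∈ Set.Icc 0 T, ∀ x : Fin d → ℝ,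
        ‖DA t x - DA s x‖ ≤ R * |t - s| ^ γ)
    (hK : ∀ s ∈ Set.Icc 0 T, ∀ t ∈ Set.Icc 0 T, ‖θ t - θ s‖ ≤ K0 * |t - s| ^ γ)
    (hI : ∀ s ∈ Set.Icc 0 T, ∀ t ∈ Set.Icc 0 T, s ≤ t → IsNYIntegral A θ s t (θ t - θ s)) :
    ∀ s t, a ≤ s → s ≤ t → t ≤ b → ‖θ t - θ s‖ ≤ 2 * R * (t - s) ^ γ := by
  have mem : ∀ s, a ≤ s → s ≤ b → s ∈ Set.Icc 0 T := fun s h h' =>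
    ⟨ha.trans h, h'.trans hb⟩
  refine boot θ γ a b R K0 hR ?_ ?_
  · intro s t hs hst ht
    have := hK s (mem s hs (hst.trans ht)) t (mem t (hs.trans hst) ht)
    rwa [abs_of_nonneg (by linarith)] at this
  · intro K hK0 hKb s t hs hst ht
    have ms := mem s hs (hst.trans ht)
    have mt := mem t (hs.trans hst) ht
    have sew := sewing (fun s t => A t (θ s) - A s (θ s)) γ ρ c (R * K) a b hρ hc hc0
      (by positivity) ?_ s t hs hst ht (θ t - θ s) (ny_tendsto (hI s ms t mt hst) hst)
    · have g := h1 s ms t mt (θ s)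
      rw [abs_of_nonneg (by linarith)] at g
      have hw : 0 ≤ (t - s) ^ γ := Real.rpow_nonneg (by linarith) _
      have hwH : (t - s) ^ γ ≤ H :=
        (Real.rpow_le_rpow (by linarith) (by linarith) hγ.le).trans hbH
      set w := (t - s) ^ γ
      have e : ‖θ t - θ s‖ ≤ ‖θ t - θ s - (A t (θ s) - A s (θ s))‖ + ‖A t (θ s) - A s (θ s)‖ := by
        simpa using norm_add_le (θ t - θ s - (A t (θ s) - A s (θ s))) (A t (θ s) - A s (θ s))
      have e2 : c * R * w ≤ 1 / 8 := (mul_le_mul_of_nonneg_left hwH (by positivity)).trans hH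
      have e3 : c * R * w * (K * w) ≤ 1 / 8 * (K * w) :=
        mul_le_mul_of_nonneg_right e2 (by positivity)
      have e4 : 0 ≤ K * w := by positivity
      nlinarith
    · intro s u t hs hsu hut ht
      have mu := mem u (hs.trans hsu) (hut.trans ht)
      have mt := mem t (hs.trans (hsu.trans hut)) ht
      have l := lip_of_deriv (fun x => A t x - A u x) (fun x => DA t x - DA u x)
        (R * |t - u| ^ γ) (fun x => (hA t x).sub (hA u x)) (fun x => h2 u mu t mt x) (θ s) (θ u)
      have k := hKb s u hs hsu (hut.trans ht)
      rw [abs_of_nonneg (by linarith)] at l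
      have w1 : (t - u) ^ γ ≤ (t - s) ^ γ := Real.rpow_le_rpow (by linarith) (by linarith) hγ.le
      have w2 : (u - s) ^ γ ≤ (t - s) ^ γ := Real.rpow_le_rpow (by linarith) (by linarith) hγ.le
      have w0 : 0 ≤ (t - u) ^ γ := Real.rpow_nonneg (by linarith) _
      have w3 : 0 ≤ (u - s) ^ γ := Real.rpow_nonneg (by linarith) _
      rw [norm_sub_rev (θ s)] at l
      calc _ = ‖A t (θ s) - A u (θ s) - (A t (θ u) - A u (θ u))‖ := by congr 1; abel
        _ ≤ R * (t - u) ^ γ * ‖θ u - θ s‖ := l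
        _ ≤ R * (t - s) ^ γ * (K * (t - s) ^ γ) := by
          have : ‖θ u - θ s‖ ≤ K * (t - s) ^ γ := k.trans (by gcongr)
          have : 0 ≤ (t - s) ^ γ := w0.trans w1
          gcongr
        _ = _ := by ring

theorem local_cmp {d : ℕ} (A1 A2 : ℝ → (Fin d → ℝ) → Fin d → ℝ)
    (DA1 : ℝ → (Fin d → ℝ) → (Fin d → ℝ) →L[ℝ] (Fin d → ℝ))
    (D2A1 : ℝ → (Fin d → ℝ) → (Fin d → ℝ) →L[ℝ] (Fin d → ℝ) →L[ℝ] (Fin d → ℝ))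
    (θ1 θ2 : ℝ → Fin d → ℝ)
    (γ ρ c T R K0 H a b Δ : ℝ) (hγ : 0 < γ)
    (hρ : ρ = 2 * ((1 / 2 : ℝ) ^ γ) ^ 2) (hc : c * ρ + 1 = c) (hc1 : 1 ≤ c) (hR : 0 ≤ R)
    (hΔ : 0 ≤ Δ)
    (ha : 0 ≤ a) (hab : a ≤ b) (hb : b ≤ T) (hH : c * R * H ≤ 1 / 8) (hbH : (b - a) ^ γ ≤ H)
    (hA : ∀ t x, HasFDerivAt (A1 t) (DA1 t x) x)
    (hDA : ∀ t x, HasFDerivAt (DA1 t) (D2A1 t x) x)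
    (h2 : ∀ s ∈ Set.Icc 0 T, ∀ t ∈ Set.Icc 0 T, ∀ x : Fin d → ℝ,
        ‖DA1 t x - DA1 s x‖ ≤ R * |t - s| ^ γ)
    (h3 : ∀ s ∈ Set.Icc 0 T, ∀ t ∈ Set.Icc 0 T, ∀ x : Fin d → ℝ,
        ‖D2A1 t x - D2A1 s x‖ ≤ R * |t - s| ^ γ)
    (hK : ∀ s ∈ Set.Icc 0 T, ∀ t ∈ Set.Icc 0 T,
        ‖θ1 t - θ1 s‖ ≤ K0 * |t - s| ^ γ ∧ ‖θ2 t - θ2 s‖ ≤ K0 * |t - s| ^ γ)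
    (hI : ∀ s ∈ Set.Icc 0 T, ∀ t ∈ Set.Icc 0 T, s ≤ t →
        IsNYIntegral A1 θ1 s t (θ1 t - θ1 s) ∧ IsNYIntegral A2 θ2 s t (θ2 t - θ2 s))
    (hθ : ∀ s t, a ≤ s → s ≤ t → t ≤ b → ‖θ2 t - θ2 s‖ ≤ 2 * R * (t - s) ^ γ)
    (d1 : ∀ s ∈ Set.Icc 0 T, ∀ t ∈ Set.Icc 0 T, ∀ x : Fin d → ℝ,
        ‖A1 t x - A2 t x - (A1 s x - A2 s x)‖ ≤ Δ * |t - s| ^ γ)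
    (d2 : ∀ s ∈ Set.Icc 0 T, ∀ t ∈ Set.Icc 0 T, ∀ x y : Fin d → ℝ,
        ‖(A1 t x - A2 t x - (A1 s x - A2 s x)) - (A1 t y - A2 t y - (A1 s y - A2 s y))‖ ≤
          Δ * |t - s| ^ γ * ‖x - y‖) :
    ‖(θ1 b - θ2 b) - (θ1 a - θ2 a)‖ ≤
      3 * (R + 1) * (‖θ1 a - θ2 a‖ + Δ) * (b - a) ^ γ := by
  have mem : ∀ s, a ≤ s → s ≤ b → s ∈ Set.Icc 0 T := fun s h h' =>
    ⟨ha.trans h, h'.trans hb⟩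
  have hH0 : 0 ≤ H := le_trans (Real.rpow_nonneg (by linarith) _) hbH
  set va := ‖θ1 a - θ2 a‖ with hva
  have hva0 : 0 ≤ va := norm_nonneg _
  have B := boot (fun t => θ1 t - θ2 t) γ a b (5 / 4 * R * va + 5 / 4 * Δ) (2 * K0)
    (by positivity) ?_ ?_ a b le_rfl hab le_rfl
  · refine B.trans ?_
    have : 0 ≤ (b - a) ^ γ := Real.rpow_nonneg (by linarith) _
    refine mul_le_mul_of_nonneg_right ?_ this
    nlinarith [mul_nonneg hR hva0, mul_nonneg hR hΔ]
  · intro s t hs hst ht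
    have := hK s (mem s hs (hst.trans ht)) t (mem t (hs.trans hst) ht)
    rw [abs_of_nonneg (by linarith)] at this
    calc _ = ‖(θ1 t - θ1 s) - (θ2 t - θ2 s)‖ := by congr 1; abel
      _ ≤ ‖θ1 t - θ1 s‖ + ‖θ2 t - θ2 s‖ := norm_sub_le _ _
      _ ≤ _ := by linarith [this.1, this.2]
  · intro K hK0 hKb s t hs hst ht
    have ms := mem s hs (hst.trans ht)
    have mt := mem t (hs.trans hst) ht
    -- sup bound
    have hV : ∀ r, a ≤ r → r ≤ b → ‖θ1 r - θ2 r‖ ≤ va + K * H := by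
      intro r har hrb
      have k := hKb a r le_rfl har hrb
      have w : (r - a) ^ γ ≤ H :=
        (Real.rpow_le_rpow (by linarith) (by linarith) hγ.le).trans hbH
      have k2 : K * (r - a) ^ γ ≤ K * H := by gcongr
      have := norm_le_norm_add_norm_sub' (θ1 r - θ2 r) (θ1 a - θ2 a)
      linarith
    set V := va + K * H with hVdef
    have hV0 : 0 ≤ V := by positivity
    have lim := (ny_tendsto (hI s ms t mt hst).1 hst).sub (ny_tendsto (hI s ms t mt hst).2 hst)
    simp only [← Finset.sum_sub_distrib] at lim
    have sew := sewing (fun s t => (A1 t (θ1 s) - A1 s (θ1 s)) - (A2 t (θ2 s) - A2 s (θ2 s)))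
      γ ρ c (R * K + 2 * R ^ 2 * V + 2 * R * Δ) a b hρ hc (by linarith)
      (by positivity) ?_ s t hs hst ht _ lim
    · have g := d1 s ms t mt (θ2 s)
      have l := lip_of_deriv (fun x => A1 t x - A1 s x) (fun x => DA1 t x - DA1 s x)
        (R * |t - s| ^ γ) (fun x => (hA t x).sub (hA s x)) (fun x => h2 s ms t mt x) (θ1 s) (θ2 s)
      rw [abs_of_nonneg (by linarith)] at g l
      have hw : 0 ≤ (t - s) ^ γ := Real.rpow_nonneg (by linarith) _
      have hwH : (t - s) ^ γ ≤ H :=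
        (Real.rpow_le_rpow (by linarith) (by linarith) hγ.le).trans hbH
      set w := (t - s) ^ γ
      have l2 : R * w * ‖θ1 s - θ2 s‖ ≤ R * w * V :=
        mul_le_mul_of_nonneg_left (hV s hs (hst.trans ht)) (by positivity)
      set Xi := (A1 t (θ1 s) - A1 s (θ1 s)) - (A2 t (θ2 s) - A2 s (θ2 s)) with hXi
      have eXi : ‖Xi‖ ≤ R * w * V + Δ * w := by
        have : Xi = (A1 t (θ1 s) - A1 s (θ1 s) - (A1 t (θ2 s) - A1 s (θ2 s))) +
          (A1 t (θ2 s) - A2 t (θ2 s) - (A1 s (θ2 s) - A2 s (θ2 s))) := by rw [hXi]; abel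
        rw [this]
        exact (norm_add_le _ _).trans (add_le_add (l.trans l2) g)
      have e : ‖θ1 t - θ2 t - (θ1 s - θ2 s)‖ ≤
          c * (R * K + 2 * R ^ 2 * V + 2 * R * Δ) * w ^ 2 + (R * w * V + Δ * w) := by
        have : θ1 t - θ2 t - (θ1 s - θ2 s) = (θ1 t - θ1 s - (θ2 t - θ2 s) - Xi) + Xi := by abel
        rw [this]
        exact (norm_add_le _ _).trans (add_le_add sew eXi)
      refine e.trans ?_
      have hM0 : 0 ≤ c * (R * K + 2 * R ^ 2 * V + 2 * R * Δ) := by positivity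
      have f1 : c * (R * K + 2 * R ^ 2 * V + 2 * R * Δ) * w ^ 2 ≤
          (c * (R * K + 2 * R ^ 2 * V + 2 * R * Δ) * H) * w := by
        rw [pow_two w, ← mul_assoc]
        exact mul_le_mul_of_nonneg_right (mul_le_mul_of_nonneg_left hwH hM0) hw
      have f2 : c * (R * K + 2 * R ^ 2 * V + 2 * R * Δ) * H + (R * V + Δ) ≤
          5 / 4 * R * va + 5 / 4 * Δ + K / 2 := by
        have x0 : 0 ≤ c * R * H := by positivity
        have y0 : 0 ≤ R * H := by positivity
        have y1 : R * H ≤ 1 / 8 := by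
          have : 1 * (R * H) ≤ c * (R * H) := by gcongr
          linarith [mul_assoc c R H]
        have g1 : c * R * H * K ≤ 1 / 8 * K := by gcongr
        have g2 : R * H * K ≤ 1 / 8 * K := by gcongr
        have g3 : c * R * H * (R * va) ≤ 1 / 8 * (R * va) := by gcongr
        have g4 : c * R * H * (R * H * K) ≤ 1 / 8 * (R * H * K) := by gcongr
        have g5 : c * R * H * Δ ≤ 1 / 8 * Δ := by gcongr
        have : c * (R * K + 2 * R ^ 2 * V + 2 * R * Δ) * H + (R * V + Δ) =
          c * R * H * K + 2 * (c * R * H * (R * va)) + 2 * (c * R * H * (R * H * K))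
            + 2 * (c * R * H * Δ) + R * va + R * H * K + Δ := by rw [hVdef]; ring
        rw [this]
        linarith
      nlinarith
    · intro s u t hs hsu hut ht
      have mu := mem u (hs.trans hsu) (hut.trans ht)
      have mt := mem t (hs.trans (hsu.trans hut)) ht
      have l := four_point (fun x => A1 t x - A1 u x) (fun x => DA1 t x - DA1 u x)
        (R * |t - u| ^ γ) (fun x => (hA t x).sub (hA u x)) (fun x => h2 u mu t mt x)
        (fun x y => lip_of_deriv (fun x => DA1 t x - DA1 u x) (fun x => D2A1 t x - D2A1 u x)
          (R * |t - u| ^ γ) (fun x => (hDA t x).sub (hDA u x)) (fun x => h3 u mu t mt x) x y)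
        (θ1 u) (θ1 s) (θ2 u) (θ2 s)
      have g := d2 u mu t mt (θ2 u) (θ2 s)
      have k := hKb s u hs hsu (hut.trans ht)
      have k2 := hθ s u hs hsu (hut.trans ht)
      have k3 := hV s hs (hsu.trans (hut.trans ht))
      rw [abs_of_nonneg (by linarith)] at l g
      have w1 : (t - u) ^ γ ≤ (t - s) ^ γ := Real.rpow_le_rpow (by linarith) (by linarith) hγ.le
      have w2 : (u - s) ^ γ ≤ (t - s) ^ γ := Real.rpow_le_rpow (by linarith) (by linarith) hγ.le
      have w0 : 0 ≤ (t - u) ^ γ := Real.rpow_nonneg (by linarith) _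
      have w3 : 0 ≤ (t - s) ^ γ := w0.trans w1
      replace k : ‖θ1 u - θ2 u - (θ1 s - θ2 s)‖ ≤ K * (t - s) ^ γ := k.trans (by gcongr)
      replace k2 : ‖θ2 u - θ2 s‖ ≤ 2 * R * (t - s) ^ γ := k2.trans (by gcongr)
      set w := (t - s) ^ γ
      have l' : R * (t - u) ^ γ * ‖θ1 u - θ2 u - (θ1 s - θ2 s)‖ +
          R * (t - u) ^ γ * ‖θ1 s - θ2 s‖ * ‖θ2 u - θ2 s‖ ≤
          R * w * (K * w) + R * w * V * (2 * R * w) := by gcongr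
      have g' : Δ * (t - u) ^ γ * ‖θ2 u - θ2 s‖ ≤ Δ * w * (2 * R * w) := by gcongr
      rw [norm_sub_rev] at l
      rw [norm_sub_rev] at g
      refine le_trans (le_trans (le_of_eq ?_) (norm_add_le_of_le (l.trans l') (g.trans g')))
        (le_of_eq ?_)
      · congr 1; abel
      · ring

/-- Comparison principle for nonlinear Young differential equations: if
`A¹, A² ∈ C^γ_t C²_x` with norms bounded by `R` (expressed through the spatial
derivatives `DAⁱ`, `D2Aⁱ`) and `θⁱ ∈ C^γ` solve `θⁱ_t = θⁱ_0 + ∫₀^t Aⁱ(ds, θⁱ_s)`, then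
`‖θ¹ - θ²‖_{C^γ} ≤ C (|θ¹_0 - θ²_0| + ‖A¹ - A²‖_{C^γ Lip})` with `C = C(γ,T,R)`;
`Δ` is a bound for `‖A¹ - A²‖_{C^γ Lip}`. -/
theorem stmt13 (γ T R : ℝ) (hγ : 1/2 < γ) (hγ1 : γ ≤ 1) (hT : 0 < T) (hR : 0 ≤ R) :
    ∃ C : ℝ, 0 < C ∧
      ∀ (d : ℕ) (A1 A2 : ℝ → (Fin d → ℝ) → Fin d → ℝ)
        (DA1 DA2 : ℝ → (Fin d → ℝ) → (Fin d → ℝ) →L[ℝ] (Fin d → ℝ))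
        (D2A1 D2A2 : ℝ → (Fin d → ℝ) → (Fin d → ℝ) →L[ℝ] (Fin d → ℝ) →L[ℝ] (Fin d → ℝ))
        (θ1 θ2 : ℝ → Fin d → ℝ) (Δ : ℝ),
      (∀ t x, HasFDerivAt (A1 t) (DA1 t x) x) →
      (∀ t x, HasFDerivAt (A2 t) (DA2 t x) x) →
      (∀ t x, HasFDerivAt (DA1 t) (D2A1 t x) x) →
      (∀ t x, HasFDerivAt (DA2 t) (D2A2 t x) x) →
      (∀ t ∈ Set.Icc 0 T, ∀ x : Fin d → ℝ,
        ‖A1 t x‖ ≤ R ∧ ‖DA1 t x‖ ≤ R ∧ ‖D2A1 t x‖ ≤ R ∧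
        ‖A2 t x‖ ≤ R ∧ ‖DA2 t x‖ ≤ R ∧ ‖D2A2 t x‖ ≤ R) →
      (∀ s ∈ Set.Icc 0 T, ∀ t ∈ Set.Icc 0 T, ∀ x : Fin d → ℝ,
        ‖A1 t x - A1 s x‖ ≤ R * |t - s| ^ γ ∧ ‖DA1 t x - DA1 s x‖ ≤ R * |t - s| ^ γ ∧
        ‖D2A1 t x - D2A1 s x‖ ≤ R * |t - s| ^ γ ∧
        ‖A2 t x - A2 s x‖ ≤ R * |t - s| ^ γ ∧ ‖DA2 t x - DA2 s x‖ ≤ R * |t - s| ^ γ ∧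
        ‖D2A2 t x - D2A2 s x‖ ≤ R * |t - s| ^ γ) →
      (∃ K : ℝ, ∀ s ∈ Set.Icc 0 T, ∀ t ∈ Set.Icc 0 T,
        ‖θ1 t - θ1 s‖ ≤ K * |t - s| ^ γ ∧ ‖θ2 t - θ2 s‖ ≤ K * |t - s| ^ γ) →
      (∀ s ∈ Set.Icc 0 T, ∀ t ∈ Set.Icc 0 T, s ≤ t →
        IsNYIntegral A1 θ1 s t (θ1 t - θ1 s) ∧ IsNYIntegral A2 θ2 s t (θ2 t - θ2 s)) →
      (∀ t ∈ Set.Icc 0 T, ∀ x : Fin d → ℝ, ‖A1 t x - A2 t x‖ ≤ Δ) →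
      (∀ t ∈ Set.Icc 0 T, ∀ x y : Fin d → ℝ,
        ‖A1 t x - A2 t x - (A1 t y - A2 t y)‖ ≤ Δ * ‖x - y‖) →
      (∀ s ∈ Set.Icc 0 T, ∀ t ∈ Set.Icc 0 T, ∀ x : Fin d → ℝ,
        ‖A1 t x - A2 t x - (A1 s x - A2 s x)‖ ≤ Δ * |t - s| ^ γ) →
      (∀ s ∈ Set.Icc 0 T, ∀ t ∈ Set.Icc 0 T, ∀ x y : Fin d → ℝ,
        ‖(A1 t x - A2 t x - (A1 s x - A2 s x)) - (A1 t y - A2 t y - (A1 s y - A2 s y))‖ ≤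
          Δ * |t - s| ^ γ * ‖x - y‖) →
      (∀ t ∈ Set.Icc 0 T, ‖θ1 t - θ2 t‖ ≤ C * (‖θ1 0 - θ2 0‖ + Δ)) ∧
      (∀ s ∈ Set.Icc 0 T, ∀ t ∈ Set.Icc 0 T,
        ‖(θ1 t - θ2 t) - (θ1 s - θ2 s)‖ ≤ C * (‖θ1 0 - θ2 0‖ + Δ) * |t - s| ^ γ) := by
  have hγ0 : 0 < γ := by linarith
  obtain ⟨ρ, hρ⟩ : ∃ ρ : ℝ, ρ = 2 * ((1 / 2 : ℝ) ^ γ) ^ 2 := ⟨_, rfl⟩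
  have hρ0 : 0 ≤ ρ := by rw [hρ]; positivity
  have hρ1 : ρ < 1 := by
    have h1 : ((1 / 2 : ℝ) ^ γ) ^ 2 = (1 / 2 : ℝ) ^ (γ * 2) := by
      rw [Real.rpow_mul (by norm_num)]; norm_cast
    have h2 : (1 / 2 : ℝ) ^ (γ * 2) < (1 / 2 : ℝ) ^ (1 : ℝ) :=
      Real.rpow_lt_rpow_of_exponent_gt (by norm_num) (by norm_num) (by linarith)
    rw [Real.rpow_one] at h2
    rw [hρ, h1]; linarith
  obtain ⟨c, hcdef⟩ : ∃ c : ℝ, c = 1 / (1 - ρ) := ⟨_, rfl⟩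
  have hρ2 : 0 < 1 - ρ := by linarith
  have hc : c * ρ + 1 = c := by rw [hcdef]; field_simp; ring
  have hc1 : 1 ≤ c := by rw [hcdef, le_div_iff₀ hρ2]; linarith
  obtain ⟨H, hHdef⟩ : ∃ H : ℝ, H = 1 / (8 * c * (R + 1)) := ⟨_, rfl⟩
  have hH0 : 0 < H := by rw [hHdef]; positivity
  have hH : c * R * H ≤ 1 / 8 := by
    rw [hHdef, mul_one_div, div_le_div_iff₀ (by positivity) (by norm_num)]
    nlinarith
  obtain ⟨h, hh⟩ : ∃ h : ℝ, h = H ^ (γ⁻¹) := ⟨_, rfl⟩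
  have hh0 : 0 < h := by rw [hh]; positivity
  have hhH : h ^ γ = H := by rw [hh]; exact Real.rpow_inv_rpow hH0.le hγ0.ne'
  obtain ⟨N, hN⟩ := exists_nat_ge (T / h)
  rw [div_le_iff₀ hh0] at hN
  obtain ⟨C1, hC1⟩ : ∃ C1 : ℝ, C1 = 3 * (R + 1) := ⟨_, rfl⟩
  have hC10 : 0 < C1 := by rw [hC1]; positivity
  obtain ⟨B, hB⟩ : ∃ B : ℝ, B = 1 + C1 * H := ⟨_, rfl⟩
  have hB1 : 1 ≤ B := by
    have : 0 ≤ C1 * H := by positivity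
    linarith
  obtain ⟨S, hS⟩ : ∃ S : ℝ, S = B ^ N := ⟨_, rfl⟩
  have hS1 : 1 ≤ S := by rw [hS]; exact one_le_pow₀ hB1
  refine ⟨S + C1 * S + 2 * S / H, by positivity, ?_⟩
  intro d A1 A2 DA1 DA2 D2A1 D2A2 θ1 θ2 Δ hA1 hA2 hDA1 hDA2 hbd hhol hK hI e1 e2 e3 e4
  obtain ⟨K0, hK⟩ := hK
  have hΔ : 0 ≤ Δ := (norm_nonneg _).trans (e1 0 ⟨le_rfl, hT.le⟩ 0)
  have loc : ∀ a b, 0 ≤ a → a ≤ b → b ≤ T → b - a ≤ h →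
      ‖(θ1 b - θ2 b) - (θ1 a - θ2 a)‖ ≤ C1 * (‖θ1 a - θ2 a‖ + Δ) * (b - a) ^ γ := by
    intro a b ha hab hb hbh
    have hbH : (b - a) ^ γ ≤ H := by
      rw [← hhH]; exact Real.rpow_le_rpow (by linarith) hbh hγ0.le
    have ap := apriori A2 DA2 θ2 γ ρ c T R K0 H a b hγ0 hρ hc (by linarith) hR ha hb hH hbH hA2
      (fun s hs t ht x => (hhol s hs t ht x).2.2.2.1)
      (fun s hs t ht x => (hhol s hs t ht x).2.2.2.2.1)
      (fun s hs t ht => (hK s hs t ht).2) (fun s hs t ht hst => (hI s hs t ht hst).2)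
    rw [hC1]
    exact local_cmp A1 A2 DA1 D2A1 θ1 θ2 γ ρ c T R K0 H a b Δ hγ0 hρ hc hc1 hR hΔ ha hab hb hH hbH
      hA1 hDA1 (fun s hs t ht x => (hhol s hs t ht x).2.1)
      (fun s hs t ht x => (hhol s hs t ht x).2.2.1) hK hI ap e3 e4
  have hD0 : 0 ≤ ‖θ1 0 - θ2 0‖ + Δ := by positivity
  have step : ∀ k : ℕ, ∀ t, 0 ≤ t → t ≤ T → t ≤ k * h →
      ‖θ1 t - θ2 t‖ + Δ ≤ B ^ k * (‖θ1 0 - θ2 0‖ + Δ) := by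
    intro k
    induction k with
    | zero =>
      intro t h0 _ h1
      have : t = 0 := le_antisymm (by simpa using h1) h0
      rw [this]; simp
    | succ k ih =>
      intro t h0 hTt h1
      push_cast at h1
      have i := ih (max (t - h) 0) (le_max_right _ _) (max_le (by linarith) hT.le)
        (max_le (by linarith) (by positivity))
      have l := loc (max (t - h) 0) t (le_max_right _ _) (max_le (by linarith) h0) hTt
        (by linarith [le_max_left (t - h) 0])
      have hw : (t - max (t - h) 0) ^ γ ≤ H := by
        rw [← hhH]
        exact Real.rpow_le_rpow (sub_nonneg.2 (max_le (by linarith) h0))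
          (by linarith [le_max_left (t - h) 0]) hγ0.le
      set a := max (t - h) 0
      have l2 : C1 * (‖θ1 a - θ2 a‖ + Δ) * (t - a) ^ γ ≤ C1 * (‖θ1 a - θ2 a‖ + Δ) * H := by
        gcongr
      have := norm_le_norm_add_norm_sub' (θ1 t - θ2 t) (θ1 a - θ2 a)
      calc ‖θ1 t - θ2 t‖ + Δ ≤ B * (‖θ1 a - θ2 a‖ + Δ) := by rw [hB]; linarith
        _ ≤ B * (B ^ k * (‖θ1 0 - θ2 0‖ + Δ)) := by gcongr
        _ = _ := by ring
  have sup : ∀ t ∈ Set.Icc 0 T, ‖θ1 t - θ2 t‖ + Δ ≤ S * (‖θ1 0 - θ2 0‖ + Δ) := by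
    intro t ht
    rw [hS]
    exact step N t ht.1 ht.2 (ht.2.trans hN)
  set D := ‖θ1 0 - θ2 0‖ + Δ
  have p1 : 0 ≤ C1 * S * D := by positivity
  have p2 : 0 ≤ 2 * S / H * D := by positivity
  have p3 : 0 ≤ S * D := by positivity
  have hol : ∀ s ∈ Set.Icc 0 T, ∀ t ∈ Set.Icc 0 T, s ≤ t →
      ‖(θ1 t - θ2 t) - (θ1 s - θ2 s)‖ ≤ (S + C1 * S + 2 * S / H) * D * (t - s) ^ γ := by
    intro s hs t ht hst
    have w0 : 0 ≤ (t - s) ^ γ := Real.rpow_nonneg (by linarith) _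
    rcases le_total (t - s) h with hle | hge
    · refine (loc s t hs.1 hst ht.2 hle).trans (mul_le_mul_of_nonneg_right ?_ w0)
      have := mul_le_mul_of_nonneg_left (sup s hs) hC10.le
      linarith
    · have w1 : H ≤ (t - s) ^ γ := by
        rw [← hhH]; exact Real.rpow_le_rpow hh0.le hge hγ0.le
      have n := norm_sub_le (θ1 t - θ2 t) (θ1 s - θ2 s)
      calc _ ≤ 2 * S * D := by linarith [sup s hs, sup t ht]
        _ = 2 * S / H * D * H := by field_simp
        _ ≤ 2 * S / H * D * (t - s) ^ γ := by gcongr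
        _ ≤ _ := mul_le_mul_of_nonneg_right (by linarith) w0
  refine ⟨fun t ht => ?_, fun s hs t ht => ?_⟩
  · linarith [sup t ht]
  · rcases le_total s t with hst | hst
    · rw [abs_of_nonneg (by linarith)]
      exact hol s hs t ht hst
    · rw [abs_sub_comm, abs_of_nonneg (by linarith), norm_sub_rev]
      exact hol t ht s hs hst
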